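/- Reciprocity for q-hit polynomials: for any Ferrers board B = B(c_1,…,c_n) with 0 ≤ c_1 ≤ ⋯ ≤ c_n ≤ n, one has T_k(B; q^{-1}) = q^{-C(n,2)} T_{n-k}(B^c; q), where B^c is the complementary Ferrers board with column heights n-c_n, n-c_{n-1}, …, n-c_1. -/

import Mathlib

open Finset
open scoped Classical

noncomputable section

variable {R : Type*} [CommRing R]

/-- The q-integer `[m]_q = 1 + q + ... + q^{m-1}`. -/
def qint (q : R) (m : ℕ) : R := ∑ i ∈ Finset.range m, q ^ i

/-- The q-factorial `[m]_q!`. -/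
def qfact (q : R) (m : ℕ) : R := ∏ i ∈ Finset.range m, qint q (i + 1)

/-- A Ferrers board inside the `n × n` grid, given by column heights `c`:
square `(i,j)` (0-based row `i`, column `j`) belongs to the board iff `i < c j`. -/
def IsFerrers (n : ℕ) (c : Fin n → ℕ) : Prop := Monotone c ∧ ∀ j, c j ≤ n

/-- The squares of the Ferrers board with column heights `c`. -/
def boardSq (n : ℕ) (c : Fin n → ℕ) : Finset (Fin n × Fin n) :=
  Finset.univ.filter fun s => (s.1 : ℕ) < c s.2

/-- A set of rooks is non-attacking when no two share a row or a column. -/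
def NonAttacking {n : ℕ} (C : Finset (Fin n × Fin n)) : Prop :=
  ∀ r ∈ C, ∀ r' ∈ C, r ≠ r' → r.1 ≠ r'.1 ∧ r.2 ≠ r'.2

/-- Placements of `k` non-attacking rooks on the Ferrers board. -/
def placements (n : ℕ) (c : Fin n → ℕ) (k : ℕ) : Finset (Finset (Fin n × Fin n)) :=
  Finset.univ.filter fun C => C.card = k ∧ C ⊆ boardSq n c ∧ NonAttacking C

/-- `inv(C,B)`: the number of squares of the board that do not contain a rook and
are not above (smaller row index, same column) nor to the right of (same row,
larger column index) any rook of `C`. -/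
def rookInv (n : ℕ) (c : Fin n → ℕ) (C : Finset (Fin n × Fin n)) : ℕ :=
  ((boardSq n c).filter fun s => s ∉ C ∧ ∀ r ∈ C,
    ¬(r.2 = s.2 ∧ s.1 < r.1) ∧ ¬(r.1 = s.1 ∧ r.2 < s.2)).card

/-- The Garsia–Remmel q-rook polynomial `R_k(B;q)`. -/
def qRook (q : R) (n : ℕ) (c : Fin n → ℕ) (k : ℕ) : R :=
  ∑ C ∈ placements n c k, q ^ rookInv n c C

/-- The polynomial (in `x`) `∑_{j=0}^n [j]_q! R_{n-j}(B;q) ∏_{i=j+1}^n (x - q^i)`. -/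
def hitGen (q : R) (n : ℕ) (c : Fin n → ℕ) : Polynomial R :=
  ∑ j ∈ Finset.range (n + 1),
    Polynomial.C (qfact q j * qRook q n c (n - j)) *
      ∏ i ∈ Finset.Icc (j + 1) n, (Polynomial.X - Polynomial.C (q ^ i))

/-- The Garsia–Remmel q-hit polynomial `T_k(B;q)`, defined by
`∑_{j=0}^n [j]_q! R_{n-j}(B;q) ∏_{i=j+1}^n (x - q^i) = ∑_k T_k(B;q) x^k`. -/
def qHit (q : R) (n : ℕ) (c : Fin n → ℕ) (k : ℕ) : R := (hitGen q n c).coeff k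

/-- Placements of `n` non-attacking rooks on the full `n × n` grid with exactly
`k` rooks on the board. -/
def fullPlacements (n : ℕ) (c : Fin n → ℕ) (k : ℕ) : Finset (Finset (Fin n × Fin n)) :=
  Finset.univ.filter fun C => C.card = n ∧ NonAttacking C ∧ (C ∩ boardSq n c).card = k

end

/-- The squares `(i, j)` with `j < n` and `i < c j`. -/
noncomputable def natBoard (n : ℕ) (c : ℕ → ℕ) : Finset (ℕ × ℕ) :=
  (Finset.range n).biUnion fun j => (Finset.range (c j)).image fun i => (i, j)

theorem mem_natBoard {n : ℕ} {c : ℕ → ℕ} {s : ℕ × ℕ} :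
    s ∈ natBoard n c ↔ s.2 < n ∧ s.1 < c s.2 := by
  obtain ⟨i, j⟩ := s
  simp only [natBoard, Finset.mem_biUnion, Finset.mem_image, Finset.mem_range, Prod.mk.injEq]
  constructor
  · rintro ⟨j', hj, i', hi, rfl, rfl⟩
    exact ⟨hj, hi⟩
  · rintro ⟨hj, hi⟩
    exact ⟨j, hj, i, hi, rfl, rfl⟩

/-- All non-attacking rook placements on `natBoard n c`. -/
noncomputable def natPlacements (n : ℕ) (c : ℕ → ℕ) : Finset (Finset (ℕ × ℕ)) :=
  (natBoard n c).powerset.filter fun C =>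
    ∀ r ∈ C, ∀ r' ∈ C, r ≠ r' → r.1 ≠ r'.1 ∧ r.2 ≠ r'.2

/-- A square neither occupied nor cancelled (upwards or to the right) by a rook of `C`. -/
def Uncancelled (C : Finset (ℕ × ℕ)) (s : ℕ × ℕ) : Prop :=
  s ∉ C ∧ ∀ r ∈ C, ¬(r.2 = s.2 ∧ s.1 < r.1) ∧ ¬(r.1 = s.1 ∧ r.2 < s.2)

theorem uncancelled_insert {C : Finset (ℕ × ℕ)} {r s : ℕ × ℕ} :
    Uncancelled (insert r C) s ↔
      (s ≠ r ∧ ¬(r.2 = s.2 ∧ s.1 < r.1) ∧ ¬(r.1 = s.1 ∧ r.2 < s.2)) ∧ Uncancelled C s := by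
  rw [Uncancelled, Uncancelled, Finset.forall_mem_insert, Finset.mem_insert]
  tauto

theorem uncancelled_iff_of_forall_lt {C : Finset (ℕ × ℕ)} {n i : ℕ} (hC : ∀ r ∈ C, r.2 < n) :
    Uncancelled C (i, n) ↔ i ∉ C.image Prod.fst := by
  rw [Finset.mem_image]
  constructor
  · rintro h ⟨r, hr, hri⟩
    exact (h.2 r hr).2 ⟨hri, hC r hr⟩
  · intro h
    exact ⟨fun hi => h ⟨_, hi, rfl⟩, fun r hr =>
      ⟨fun h' => (hC r hr).ne h'.1, fun h' => h ⟨r, hr, h'.1⟩⟩⟩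

/-- The inversion statistic of a placement on `natBoard n c`. -/
noncomputable def natInv (n : ℕ) (c : ℕ → ℕ) (C : Finset (ℕ × ℕ)) : ℕ :=
  ((natBoard n c).filter (Uncancelled C)).card

theorem mem_natPlacements {n : ℕ} {c : ℕ → ℕ} {C : Finset (ℕ × ℕ)} :
    C ∈ natPlacements n c ↔ (∀ r ∈ C, r.2 < n ∧ r.1 < c r.2) ∧
      ∀ r ∈ C, ∀ r' ∈ C, r ≠ r' → r.1 ≠ r'.1 ∧ r.2 ≠ r'.2 := by
  simp only [natPlacements, Finset.mem_filter, Finset.mem_powerset, Finset.subset_iff,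
    mem_natBoard]

theorem card_image_fst_of_mem_natPlacements {n : ℕ} {c : ℕ → ℕ} {C : Finset (ℕ × ℕ)}
    (hC : C ∈ natPlacements n c) : (C.image Prod.fst).card = C.card := by
  rw [mem_natPlacements] at hC
  refine Finset.card_image_of_injOn fun r hr r' hr' h => ?_
  by_contra hne
  exact (hC.2 r hr r' hr' hne).1 h

theorem card_le_of_mem_natPlacements {n : ℕ} {c : ℕ → ℕ} {C : Finset (ℕ × ℕ)}
    (hC : C ∈ natPlacements n c) : C.card ≤ n := by
  rw [mem_natPlacements] at hC
  have h : (C.image Prod.snd).card = C.card := by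
    refine Finset.card_image_of_injOn fun r hr r' hr' h => ?_
    by_contra hne
    exact (hC.2 r hr r' hr' hne).2 h
  rw [← h, ← Finset.card_range n]
  refine Finset.card_le_card fun j hj => ?_
  obtain ⟨r, hr, rfl⟩ := Finset.mem_image.1 hj
  exact Finset.mem_range.2 (hC.1 r hr).1

/-- The rows of the column with index `n` not cancelled by the rooks of `C`. -/
noncomputable def freeRows (n : ℕ) (c : ℕ → ℕ) (C : Finset (ℕ × ℕ)) : Finset ℕ :=
  Finset.range (c n) \ C.image Prod.fst

theorem image_fst_subset_range {n : ℕ} {c : ℕ → ℕ} (hc : Monotone c) {C : Finset (ℕ × ℕ)}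
    (hC : C ∈ natPlacements n c) : C.image Prod.fst ⊆ Finset.range (c n) := by
  rw [mem_natPlacements] at hC
  intro i hi
  obtain ⟨r, hr, rfl⟩ := Finset.mem_image.1 hi
  exact Finset.mem_range.2 ((hC.1 r hr).2.trans_le (hc (hC.1 r hr).1.le))

theorem card_le_height {n : ℕ} {c : ℕ → ℕ} (hc : Monotone c) {C : Finset (ℕ × ℕ)}
    (hC : C ∈ natPlacements n c) : C.card ≤ c n := by
  have := Finset.card_le_card (image_fst_subset_range hc hC)
  rwa [card_image_fst_of_mem_natPlacements hC, Finset.card_range] at this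

theorem card_freeRows {n : ℕ} {c : ℕ → ℕ} (hc : Monotone c) {C : Finset (ℕ × ℕ)}
    (hC : C ∈ natPlacements n c) : (freeRows n c C).card = c n - C.card := by
  rw [freeRows, Finset.card_sdiff_of_subset (image_fst_subset_range hc hC), Finset.card_range,
    card_image_fst_of_mem_natPlacements hC]

theorem natInv_succ (n : ℕ) (c : ℕ → ℕ) (C : Finset (ℕ × ℕ)) :
    natInv (n + 1) c C = natInv n c C +
      ((Finset.range (c n)).filter fun i => Uncancelled C (i, n)).card := by
  have h : natBoard (n + 1) c =
      natBoard n c ∪ (Finset.range (c n)).image fun i => (i, n) := by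
    rw [natBoard, natBoard, Finset.range_add_one, Finset.biUnion_insert, Finset.union_comm]
  rw [natInv, natInv, h, Finset.filter_union, Finset.card_union_of_disjoint]
  · congr 1
    rw [Finset.filter_image, Finset.card_image_of_injective]
    intro i i' h
    simpa using h
  · refine Finset.disjoint_filter_filter (Finset.disjoint_left.2 fun s hs hs' => ?_)
    rw [mem_natBoard] at hs
    obtain ⟨i, -, rfl⟩ := Finset.mem_image.1 hs'
    exact lt_irrefl _ hs.1

theorem natInv_succ_of_mem {n : ℕ} {c : ℕ → ℕ} (hc : Monotone c) {C : Finset (ℕ × ℕ)}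
    (hC : C ∈ natPlacements n c) :
    natInv (n + 1) c C = natInv n c C + (c n - C.card) := by
  rw [natInv_succ, ← card_freeRows hc hC]
  rw [mem_natPlacements] at hC
  congr 2
  ext i
  rw [Finset.mem_filter, freeRows, Finset.mem_sdiff,
    uncancelled_iff_of_forall_lt fun r hr => (hC.1 r hr).1]

theorem natInv_insert {n : ℕ} {c : ℕ → ℕ} {C : Finset (ℕ × ℕ)}
    (hC : C ∈ natPlacements n c) (a : ℕ) :
    natInv (n + 1) c (insert (a, n) C) =
      natInv n c C + ((freeRows n c C).filter fun i => a < i).card := by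
  rw [mem_natPlacements] at hC
  rw [natInv_succ]
  congr 1
  · rw [natInv, natInv]
    congr 1
    ext s
    rw [Finset.mem_filter, Finset.mem_filter]
    refine and_congr_right fun hs => ?_
    rw [mem_natBoard] at hs
    rw [uncancelled_insert, and_iff_right]
    refine ⟨?_, fun h => hs.1.ne' h.1, fun h => hs.1.not_gt h.2⟩
    rintro rfl
    exact lt_irrefl _ hs.1
  · congr 1
    ext i
    rw [Finset.mem_filter, Finset.mem_filter, freeRows, Finset.mem_sdiff, uncancelled_insert,
      uncancelled_iff_of_forall_lt fun r hr => (hC.1 r hr).1]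
    have : ((i, n) ≠ (a, n) ∧ ¬(n = n ∧ i < a) ∧ ¬(a = i ∧ n < n)) ↔ a < i := by
      simp only [ne_eq, Prod.mk.injEq, and_true, true_and, lt_irrefl, and_false,
        not_false_eq_true]
      omega
    rw [this]
    tauto

theorem sum_pow_card_filter_lt {R : Type*} [CommRing R] (q : R) (A : Finset ℕ) :
    ∑ a ∈ A, q ^ (A.filter fun i => a < i).card = qint q A.card := by
  induction A using Finset.induction_on_min with
  | empty => simp [qint]
  | insert a s ha ih =>
    have has : a ∉ s := fun h => lt_irrefl _ (ha a h)
    rw [Finset.sum_insert has, Finset.card_insert_of_notMem has, qint, Finset.sum_range_succ,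
      ← qint, ← ih, add_comm]
    congr 1
    · refine Finset.sum_congr rfl fun b hb => ?_
      rw [Finset.filter_insert, if_neg (ha b hb).not_gt]
    · rw [Finset.filter_insert, if_neg (lt_irrefl a), Finset.filter_true_of_mem ha]

theorem filter_natPlacements_succ {n : ℕ} {c : ℕ → ℕ}
    {C : Finset (ℕ × ℕ)} (hC : C ∈ natPlacements n c) :
    ((natPlacements (n + 1) c).filter fun D => D.filter (fun r => r.2 < n) = C) =
      insert C ((freeRows n c C).image fun a => insert (a, n) C) := by
  rw [mem_natPlacements] at hC
  ext D
  simp only [Finset.mem_filter, Finset.mem_insert, Finset.mem_image, mem_natPlacements]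
  constructor
  · rintro ⟨hD, rfl⟩
    by_cases h : ∃ a, (a, n) ∈ D
    · obtain ⟨a, ha⟩ := h
      refine Or.inr ⟨a, ?_, ?_⟩
      · simp only [freeRows, Finset.mem_sdiff, Finset.mem_range, Finset.mem_image,
          Finset.mem_filter, not_exists, not_and]
        refine ⟨(hD.1 _ ha).2, fun r hr hra => ?_⟩
        refine (hD.2 r hr.1 _ ha ?_).1 hra
        rintro rfl
        exact lt_irrefl _ hr.2
      · ext r
        simp only [Finset.mem_insert, Finset.mem_filter]
        constructor
        · rintro (rfl | h)
          exacts [ha, h.1]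
        · intro hr
          by_cases hra : r = (a, n)
          · exact Or.inl hra
          · have h1 := (hD.2 r hr _ ha hra).2
            have h2 := (hD.1 r hr).1
            exact Or.inr ⟨hr, by simp only at h1; omega⟩
    · left
      symm
      refine Finset.filter_true_of_mem fun r hr => ?_
      have h2 := (hD.1 r hr).1
      have h1 : r.2 ≠ n := by
        rintro rfl
        exact h ⟨r.1, hr⟩
      omega
  · rintro (rfl | ⟨a, ha, rfl⟩)
    · exact ⟨⟨fun r hr => ⟨(hC.1 r hr).1.trans n.lt_succ_self, (hC.1 r hr).2⟩, hC.2⟩,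
        Finset.filter_true_of_mem fun r hr => (hC.1 r hr).1⟩
    · simp only [freeRows, Finset.mem_sdiff, Finset.mem_range, Finset.mem_image, not_exists,
        not_and] at ha
      refine ⟨⟨?_, ?_⟩, ?_⟩
      · rw [Finset.forall_mem_insert]
        exact ⟨⟨n.lt_succ_self, ha.1⟩,
          fun r hr => ⟨(hC.1 r hr).1.trans n.lt_succ_self, (hC.1 r hr).2⟩⟩
      · have key : ∀ r ∈ C, r.1 ≠ a ∧ r.2 ≠ n := fun r hr => ⟨ha.2 r hr, (hC.1 r hr).1.ne⟩
        intro r hr r' hr' hne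
        rcases Finset.mem_insert.1 hr with rfl | hr <;> rcases Finset.mem_insert.1 hr' with rfl | hr'
        · exact absurd rfl hne
        · exact ⟨(key r' hr').1.symm, (key r' hr').2.symm⟩
        · exact key r hr
        · exact hC.2 r hr r' hr' hne
      · rw [Finset.filter_insert, if_neg (lt_irrefl n)]
        exact Finset.filter_true_of_mem fun r hr => (hC.1 r hr).1

theorem sum_natPlacements_succ {R : Type*} [CommRing R] (q : R) (n : ℕ) {c : ℕ → ℕ}
    (hc : Monotone c) (f : ℕ → R) :
    ∑ C ∈ natPlacements (n + 1) c, q ^ natInv (n + 1) c C * f C.card =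
      ∑ C ∈ natPlacements n c, q ^ natInv n c C *
        (q ^ (c n - C.card) * f C.card + qint q (c n - C.card) * f (C.card + 1)) := by
  rw [← Finset.sum_fiberwise_of_maps_to (t := natPlacements n c)
    (g := fun D => D.filter fun r => r.2 < n)]
  · refine Finset.sum_congr rfl fun C hC => ?_
    have hC' := mem_natPlacements.1 hC
    have hnot : ∀ a, (a, n) ∉ C := fun a ha => lt_irrefl _ (hC'.1 _ ha).1
    rw [filter_natPlacements_succ hC, Finset.sum_insert, Finset.sum_image,
      natInv_succ_of_mem hc hC, ← card_freeRows hc hC, ← sum_pow_card_filter_lt q (freeRows n c C),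
      mul_add, Finset.sum_mul, Finset.mul_sum]
    · congr 1
      · ring
      · refine Finset.sum_congr rfl fun a _ => ?_
        rw [natInv_insert hC, Finset.card_insert_of_notMem (hnot a)]
        ring
    · intro a _ b _ hab
      have : (a, n) ∈ insert (b, n) C := by
        simp only at hab
        rw [← hab]
        exact Finset.mem_insert_self _ _
      rcases Finset.mem_insert.1 this with h | h
      · exact (Prod.mk.inj h).1
      · exact absurd h (hnot a)
    · intro h
      obtain ⟨a, -, ha⟩ := Finset.mem_image.1 h
      exact hnot a (ha ▸ Finset.mem_insert_self _ _)
  · intro D hD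
    rw [mem_natPlacements] at hD ⊢
    refine ⟨fun r hr => ?_, fun r hr r' hr' => ?_⟩
    · rw [Finset.mem_filter] at hr
      exact ⟨hr.2, (hD.1 r hr.1).2⟩
    · exact hD.2 r (Finset.mem_filter.1 hr).1 r' (Finset.mem_filter.1 hr').1

open Polynomial in
/-- The contribution of a placement of `r` rooks to the hit generating polynomial. -/
noncomputable def hitWeight {R : Type*} [CommRing R] (q : R) (n r : ℕ) : R[X] :=
  C (qfact q (n - r)) * ∏ i ∈ Finset.Icc (n - r + 1) n, (X - C (q ^ i))

open Polynomial in
/-- The hit generating polynomial of `natBoard n c`. -/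
noncomputable def natHitGen {R : Type*} [CommRing R] (q : R) (n : ℕ) (c : ℕ → ℕ) : R[X] :=
  ∑ D ∈ natPlacements n c, C q ^ natInv n c D * hitWeight q n D.card

open Polynomial in
theorem one_sub_C_mul_qint {R : Type*} [CommRing R] (q : R) (m : ℕ) :
    (1 - C q) * qint (C q) m = 1 - C q ^ m :=
  mul_neg_geom_sum _ _

open Polynomial in
theorem one_sub_C_mul_C_qfact_succ {R : Type*} [CommRing R] (q : R) (m : ℕ) :
    (1 - C q) * C (qfact q (m + 1)) = C (qfact q m) * (1 - C q ^ (m + 1)) := by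
  have : C (qint q (m + 1)) = qint (C q) (m + 1) := by simp [qint]
  rw [qfact, Finset.prod_range_succ, ← qfact, C_mul, this, ← one_sub_C_mul_qint]
  ring

open Polynomial in
theorem pow_card_mul_prod_comp {F : Type*} [Field F] {q : F} (hq : q ≠ 0) (s : Finset ℕ) :
    C q ^ s.card * (∏ i ∈ s, (X - C (q ^ i))).comp (C q⁻¹ * X) =
      ∏ i ∈ s, (X - C (q ^ (i + 1))) := by
  rw [Polynomial.prod_comp, ← Finset.prod_const, ← Finset.prod_mul_distrib]
  refine Finset.prod_congr rfl fun i _ => ?_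
  rw [sub_comp, X_comp, C_comp, mul_sub, ← mul_assoc, ← C_mul, ← C_mul, mul_inv_cancel₀ hq, C_1,
    one_mul, pow_succ']

open Polynomial in
theorem hitWeight_step {F : Type*} [Field F] {q : F} (hq : q ≠ 0) {n m r : ℕ} (hn : r ≤ n)
    (hm : r ≤ m) :
    (1 - C q) * (C q ^ (m - r) * hitWeight q (n + 1) r +
        qint (C q) (m - r) * hitWeight q (n + 1) (r + 1)) =
      (X - C (q ^ (n + 1))) * hitWeight q n r +
        C q ^ m * (1 - X) * (hitWeight q n r).comp (C q⁻¹ * X) := by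
  obtain ⟨j, rfl⟩ := Nat.exists_eq_add_of_le' hn
  obtain ⟨d, rfl⟩ := Nat.exists_eq_add_of_le' hm
  have e1 : j + r + 1 - r = j + 1 := by omega
  have e2 : j + r + 1 - (r + 1) = j := by omega
  simp only [hitWeight, e1, e2, Nat.add_sub_cancel, mul_comp, C_comp]
  have hshift : ∏ i ∈ Finset.Icc (j + 1 + 1) (j + r + 1), (X - C (q ^ i)) =
      C q ^ r * (∏ i ∈ Finset.Icc (j + 1) (j + r), (X - C (q ^ i))).comp (C q⁻¹ * X) := by
    have := pow_card_mul_prod_comp hq (Finset.Icc (j + 1) (j + r))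
    rw [Nat.card_Icc, show j + r + 1 - (j + 1) = r by omega] at this
    rw [this, ← Finset.map_add_right_Icc, Finset.prod_map]
    rfl
  have hbot : ∏ i ∈ Finset.Icc (j + 1) (j + r + 1), (X - C (q ^ i)) =
      (X - C (q ^ (j + 1))) * ∏ i ∈ Finset.Icc (j + 1 + 1) (j + r + 1), (X - C (q ^ i)) := by
    rw [← Finset.insert_Icc_add_one_left_eq_Icc (by omega), Finset.prod_insert (by simp)]
  have htop : ∏ i ∈ Finset.Icc (j + 1) (j + r + 1), (X - C (q ^ i)) =
      (X - C (q ^ (j + r + 1))) * ∏ i ∈ Finset.Icc (j + 1) (j + r), (X - C (q ^ i)) := by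
    rw [← Finset.insert_Icc_right_eq_Icc_add_one (by omega), Finset.prod_insert (by simp)]
  have h3 := htop.symm.trans hbot
  have h1 := one_sub_C_mul_C_qfact_succ q j
  have h2 := one_sub_C_mul_qint q d
  rw [hbot, pow_add (C q) d r, mul_left_comm (X - C (q ^ (j + r + 1))), h3]
  generalize ∏ i ∈ Finset.Icc (j + 1 + 1) (j + r + 1), (X - C (q ^ i)) = P at hshift ⊢
  rw [C_pow]
  linear_combination C q ^ d * P * h1 + C (qfact q j) * (X - C q ^ (j + 1)) * P * h2 +
    C q ^ d * (1 - X) * C (qfact q j) * hshift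

open Polynomial in
theorem natHitGen_succ {F : Type*} [Field F] {q : F} (hq : q ≠ 0) (n : ℕ) {c : ℕ → ℕ}
    (hc : Monotone c) :
    (1 - C q) * natHitGen q (n + 1) c = (X - C (q ^ (n + 1))) * natHitGen q n c +
      C q ^ c n * (1 - X) * (natHitGen q n c).comp (C q⁻¹ * X) := by
  rw [natHitGen, sum_natPlacements_succ (C q) n hc (hitWeight q (n + 1)), natHitGen,
    Polynomial.sum_comp, Finset.mul_sum, Finset.mul_sum, Finset.mul_sum, ← Finset.sum_add_distrib]
  refine Finset.sum_congr rfl fun D hD => ?_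
  have := hitWeight_step hq (card_le_of_mem_natPlacements hD) (card_le_height hc hD)
  rw [mul_comp, pow_comp, C_comp]
  linear_combination C q ^ natInv n c D * this

open Polynomial in
/-- The linear map sending `X ^ j` to `∏ i ≠ j, (X - q ^ i)`, the product over `0 ≤ i ≤ n`. -/
noncomputable def omitMap {R : Type*} [CommRing R] (q : R) (n : ℕ) (p : R[X]) : R[X] :=
  ∑ j ∈ Finset.range (n + 1),
    C (p.coeff j) * ∏ i ∈ (Finset.range (n + 1)).erase j, (X - C (q ^ i))

open Polynomial in
theorem omitMap_succ_mul {F : Type*} [Field F] {q : F} (hq : q ≠ 0) {n : ℕ} {p : F[X]}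
    (hp : p.natDegree ≤ n) (a : F) :
    omitMap q (n + 1) (p * (1 - C a * X)) = (X - C (q ^ (n + 1))) * omitMap q n p +
      C (a * q ^ n) * (1 - X) * (omitMap q n p).comp (C q⁻¹ * X) := by
  have hcoeff : p * (1 - C a * X) = p - C a * (p * X) := by ring
  have hsplit : omitMap q (n + 1) (p * (1 - C a * X)) =
      omitMap q (n + 1) p - C a * omitMap q (n + 1) (p * X) := by
    simp only [omitMap, hcoeff, coeff_sub, coeff_C_mul, C_sub, C_mul, sub_mul,
      Finset.sum_sub_distrib, Finset.mul_sum, mul_assoc]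
  have h1 : omitMap q (n + 1) p = (X - C (q ^ (n + 1))) * omitMap q n p := by
    rw [omitMap, Finset.sum_range_succ, coeff_eq_zero_of_natDegree_lt (Nat.lt_succ_of_le hp), C_0,
      zero_mul, add_zero, omitMap, Finset.mul_sum]
    refine Finset.sum_congr rfl fun j hj => ?_
    rw [Finset.range_add_one (n := n + 1),
      Finset.erase_insert_of_ne (Finset.mem_range.1 hj).ne', Finset.prod_insert (by simp)]
    ring
  have h2 : omitMap q (n + 1) (p * X) =
      (X - 1) * (C (q ^ n) * (omitMap q n p).comp (C q⁻¹ * X)) := by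
    rw [omitMap, Finset.sum_range_succ', coeff_mul_X_zero, C_0, zero_mul, add_zero, omitMap,
      Polynomial.sum_comp, Finset.mul_sum, Finset.mul_sum]
    refine Finset.sum_congr rfl fun j hj => ?_
    have hs : (Finset.range (n + 1 + 1)).erase (j + 1) =
        insert 0 (((Finset.range (n + 1)).erase j).map (addRightEmbedding 1)) := by
      ext i
      cases i <;> simp
    have hcard : ((Finset.range (n + 1)).erase j).card = n := by
      rw [Finset.card_erase_of_mem hj, Finset.card_range, Nat.add_sub_cancel]
    have hshift := pow_card_mul_prod_comp hq ((Finset.range (n + 1)).erase j)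
    rw [hcard] at hshift
    rw [hs, Finset.prod_insert (by simp), Finset.prod_map, pow_zero, C_1, coeff_mul_X, mul_comp,
      C_comp, C_pow]
    simp only [addRightEmbedding_apply]
    rw [← hshift]
    ring
  rw [hsplit, h1, h2, C_mul]
  ring

open Polynomial in
theorem natDegree_prod_one_sub_le {R ι : Type*} [CommRing R] (s : Finset ι) (a : ι → R) :
    (∏ i ∈ s, (1 - C (a i) * X)).natDegree ≤ s.card := by
  refine (natDegree_prod_le _ _).trans ?_
  rw [Finset.card_eq_sum_ones]
  refine Finset.sum_le_sum fun i _ => ?_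
  compute_degree

open Polynomial in
theorem one_sub_pow_mul_natHitGen {F : Type*} [Field F] {q : F} (hq : q ≠ 0) {c : ℕ → ℕ}
    (hc : Monotone c) (n : ℕ) :
    (1 - C q) ^ n * natHitGen q n c =
      omitMap q n (∏ i ∈ Finset.range n, (1 - C (q ^ ((c i : ℤ) - i)) * X)) := by
  induction n with
  | zero =>
    have : natPlacements 0 c = {∅} := by
      ext D
      rw [mem_natPlacements, Finset.mem_singleton]
      constructor
      · intro h
        exact Finset.eq_empty_of_forall_notMem fun r hr => absurd (h.1 r hr).1 (Nat.not_lt_zero _)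
      · rintro rfl
        simp
    simp [natHitGen, this, natInv, natBoard, hitWeight, qfact, omitMap]
  | succ n ih =>
    have hdeg : (∏ i ∈ Finset.range n, (1 - C (q ^ ((c i : ℤ) - i)) * X)).natDegree ≤ n := by
      simpa using natDegree_prod_one_sub_le (Finset.range n) fun i => q ^ ((c i : ℤ) - i)
    have hpow : q ^ ((c n : ℤ) - n) * q ^ n = q ^ c n := by
      rw [← zpow_natCast q n, ← zpow_add₀ hq, sub_add_cancel, zpow_natCast]
    rw [Finset.prod_range_succ, omitMap_succ_mul hq hdeg, ← ih, hpow, pow_succ, mul_assoc,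
      natHitGen_succ hq n hc, mul_comp, pow_comp, sub_comp, one_comp, C_comp, C_pow, C_pow]
    ring

open Polynomial in
theorem reflect_prod_X_sub_C {F : Type*} [Field F] {q : F} (hq : q ≠ 0) (s : Finset ℕ) :
    reflect s.card (∏ i ∈ s, (X - C (q ^ i))) =
      C ((-1) ^ s.card * ∏ i ∈ s, q ^ i) * ∏ i ∈ s, (X - C (q⁻¹ ^ i)) := by
  induction s using Finset.induction_on with
  | empty => simp
  | insert a s ha ih =>
    have hlin : reflect 1 (X - C (q ^ a)) = C (-q ^ a) * (X - C (q⁻¹ ^ a)) := by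
      rw [reflect_sub, reflect_C, ← pow_one X, reflect_monomial, mul_sub, ← C_mul]
      have : -q ^ a * q⁻¹ ^ a = -1 := by
        rw [neg_mul, ← mul_pow, mul_inv_cancel₀ hq, one_pow]
      rw [this]
      simp
      ring
    rw [Finset.prod_insert ha, Finset.prod_insert ha, Finset.prod_insert ha,
      Finset.card_insert_of_notMem ha, add_comm, reflect_mul _ _ (natDegree_X_sub_C_le _)
        (natDegree_finsetProd_X_sub_C_eq_card _ _).le, ih, hlin]
    simp only [C_mul, pow_add, C_neg, pow_one, C_1]
    ring

open Polynomial in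
theorem coeff_sub_omitMap {F : Type*} [Field F] {q : F} (hq : q ≠ 0) {n k : ℕ} (hk : k ≤ n)
    (p : F[X]) :
    (omitMap q n p).coeff (n - k) = (-1) ^ n * q ^ ((n + 1).choose 2) *
      (omitMap q⁻¹ n (p.comp (C q⁻¹ * X))).coeff k := by
  rw [omitMap, omitMap, finsetSum_coeff, finsetSum_coeff, Finset.mul_sum]
  refine Finset.sum_congr rfl fun j hj => ?_
  have hcard : ((Finset.range (n + 1)).erase j).card = n := by
    rw [Finset.card_erase_of_mem hj, Finset.card_range, Nat.add_sub_cancel]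
  have hprod : ∏ i ∈ (Finset.range (n + 1)).erase j, q ^ i = q ^ ((n + 1).choose 2) * q⁻¹ ^ j := by
    rw [inv_pow, eq_mul_inv_iff_mul_eq₀ (pow_ne_zero j hq), Finset.prod_erase_mul _ _ hj,
      Finset.prod_pow_eq_pow_sum, Finset.sum_range_id, Nat.choose_two_right, Nat.add_sub_cancel]
  have h := congrArg (fun f => coeff f k)
    (reflect_prod_X_sub_C hq ((Finset.range (n + 1)).erase j))
  simp only [hcard, hprod, coeff_reflect, revAt_le hk, coeff_C_mul] at h
  rw [coeff_C_mul, coeff_C_mul, h, comp_C_mul_X_coeff]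
  ring

/-- Column heights on `Fin n` extended by `n` to all columns. -/
def extendHeights (n : ℕ) (c : Fin n → ℕ) (j : ℕ) : ℕ :=
  if h : j < n then c ⟨j, h⟩ else n

theorem extendHeights_val {n : ℕ} (c : Fin n → ℕ) (j : Fin n) :
    extendHeights n c j = c j :=
  dif_pos j.2

theorem IsFerrers.monotone_extendHeights {n : ℕ} {c : Fin n → ℕ} (hc : IsFerrers n c) :
    Monotone (extendHeights n c) := by
  intro i j hij
  unfold extendHeights
  split_ifs with hi hj hj
  · exact hc.1 hij
  · exact hc.2 _
  · omega
  · exact le_rfl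

theorem IsFerrers.complement {n : ℕ} {c : Fin n → ℕ} (hc : IsFerrers n c) :
    IsFerrers n fun j => n - c (Fin.rev j) :=
  ⟨fun _ _ hij => Nat.sub_le_sub_left (hc.1 (Fin.rev_le_rev.2 hij)) n, fun _ => Nat.sub_le _ _⟩

/-- The inclusion of the `n × n` grid into `ℕ × ℕ`. -/
def gridEmbedding (n : ℕ) : Fin n × Fin n ↪ ℕ × ℕ :=
  Fin.valEmbedding.prodMap Fin.valEmbedding

theorem gridEmbedding_apply {n : ℕ} (s : Fin n × Fin n) :
    gridEmbedding n s = ((s.1 : ℕ), (s.2 : ℕ)) := rfl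

theorem exists_gridEmbedding_eq {n : ℕ} {c : Fin n → ℕ} (hc : IsFerrers n c) {s : ℕ × ℕ}
    (hs : s.2 < n ∧ s.1 < extendHeights n c s.2) : ∃ t, gridEmbedding n t = s := by
  have h1 : s.1 < n := hs.2.trans_le (by
    rw [extendHeights, dif_pos hs.1]
    exact hc.2 _)
  exact ⟨(⟨s.1, h1⟩, ⟨s.2, hs.1⟩), rfl⟩

theorem map_gridEmbedding_mem_natPlacements {n : ℕ} {c : Fin n → ℕ}
    {C : Finset (Fin n × Fin n)} :
    C.map (gridEmbedding n) ∈ natPlacements n (extendHeights n c) ↔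
      C ⊆ boardSq n c ∧ NonAttacking C := by
  simp only [mem_natPlacements, Finset.forall_mem_map, NonAttacking, boardSq, Finset.subset_iff,
    Finset.mem_filter, Finset.mem_univ, true_and, gridEmbedding_apply, extendHeights_val,
    Fin.is_lt, ne_eq, Fin.val_inj, Prod.ext_iff]

theorem natInv_map_gridEmbedding {n : ℕ} {c : Fin n → ℕ} (hc : IsFerrers n c)
    (C : Finset (Fin n × Fin n)) :
    natInv n (extendHeights n c) (C.map (gridEmbedding n)) = rookInv n c C := by
  have key : ∀ s : Fin n × Fin n, Uncancelled (C.map (gridEmbedding n)) (gridEmbedding n s) ↔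
      s ∉ C ∧ ∀ r ∈ C, ¬(r.2 = s.2 ∧ s.1 < r.1) ∧ ¬(r.1 = s.1 ∧ r.2 < s.2) := by
    intro s
    rw [Uncancelled, Finset.mem_map']
    simp only [Finset.forall_mem_map, gridEmbedding_apply,
      Fin.val_inj, Fin.lt_def]
  rw [natInv, rookInv, ← Finset.card_map (gridEmbedding n)]
  congr 1
  ext s
  simp only [Finset.mem_filter, Finset.mem_map, mem_natBoard, boardSq, Finset.mem_univ, true_and]
  constructor
  · rintro ⟨hs, hu⟩
    obtain ⟨t, rfl⟩ := exists_gridEmbedding_eq hc hs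
    refine ⟨t, ⟨?_, (key t).1 hu⟩, rfl⟩
    simpa [gridEmbedding_apply, extendHeights_val] using hs
  · rintro ⟨t, ⟨ht, hu⟩, rfl⟩
    refine ⟨?_, (key t).2 hu⟩
    simpa [gridEmbedding_apply, extendHeights_val] using ht

theorem qRook_eq_sum_natPlacements {R : Type*} [CommRing R] (q : R) {n : ℕ} {c : Fin n → ℕ}
    (hc : IsFerrers n c) (k : ℕ) :
    qRook q n c k = ∑ D ∈ natPlacements n (extendHeights n c) with D.card = k,
      q ^ natInv n (extendHeights n c) D := by
  rw [qRook]
  refine Finset.sum_bij (fun C _ => C.map (gridEmbedding n)) ?_ ?_ ?_ ?_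
  · intro C hC
    simp only [placements, Finset.mem_filter, Finset.mem_univ, true_and] at hC
    exact Finset.mem_filter.2
      ⟨map_gridEmbedding_mem_natPlacements.2 hC.2, by rw [Finset.card_map, hC.1]⟩
  · intro C _ C' _ h
    exact Finset.map_injective _ h
  · intro D hD
    rw [Finset.mem_filter] at hD
    have hmap : (Finset.univ.filter fun t => gridEmbedding n t ∈ D).map (gridEmbedding n) = D := by
      ext s
      simp only [Finset.mem_map, Finset.mem_filter, Finset.mem_univ, true_and]
      constructor
      · rintro ⟨t, ht, rfl⟩
        exact ht
      · intro hs
        obtain ⟨t, rfl⟩ := exists_gridEmbedding_eq hc ((mem_natPlacements.1 hD.1).1 s hs)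
        exact ⟨t, hs, rfl⟩
    refine ⟨Finset.univ.filter fun t => gridEmbedding n t ∈ D, ?_, hmap⟩
    simp only [placements, Finset.mem_filter, Finset.mem_univ, true_and]
    refine ⟨?_, map_gridEmbedding_mem_natPlacements.1 (by rw [hmap]; exact hD.1)⟩
    rw [← Finset.card_map (gridEmbedding n), hmap, hD.2]
  · intro C _
    rw [natInv_map_gridEmbedding hc]

theorem hitGen_eq_natHitGen {R : Type*} [CommRing R] (q : R) {n : ℕ} {c : Fin n → ℕ}
    (hc : IsFerrers n c) : hitGen q n c = natHitGen q n (extendHeights n c) := by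
  rw [hitGen, ← Finset.sum_range_reflect, natHitGen,
    ← Finset.sum_fiberwise_of_maps_to (t := Finset.range (n + 1)) (g := Finset.card)
      fun D hD => Finset.mem_range.2 (Nat.lt_succ_of_le (card_le_of_mem_natPlacements hD))]
  refine Finset.sum_congr rfl fun r hr => ?_
  have hr' := Finset.mem_range.1 hr
  rw [Nat.add_sub_cancel, Nat.sub_sub_self (Nat.lt_succ_iff.1 hr'), qRook_eq_sum_natPlacements q hc,
    Polynomial.C_mul, map_sum, Finset.mul_sum, Finset.sum_mul]
  refine Finset.sum_congr rfl fun D hD => ?_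
  rw [(Finset.mem_filter.1 hD).2, hitWeight, Polynomial.C_pow]
  ring

open Polynomial in
theorem one_sub_pow_mul_qHit {F : Type*} [Field F] {q : F} (hq : q ≠ 0) {n : ℕ} {c : Fin n → ℕ}
    (hc : IsFerrers n c) (k : ℕ) :
    (1 - q) ^ n * qHit q n c k =
      (omitMap q n (∏ j : Fin n, (1 - C (q ^ ((c j : ℤ) - (j : ℕ))) * X))).coeff k := by
  have h := congrArg (fun p => coeff p k)
    (one_sub_pow_mul_natHitGen hq hc.monotone_extendHeights n)
  simp only [← hitGen_eq_natHitGen q hc, ← C_1, ← C_sub, ← C_pow, coeff_C_mul] at h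
  rw [qHit, h, C_1, Finset.prod_range]
  simp only [extendHeights_val]

open Polynomial in
/-- Reciprocity for q-hit polynomials over a field, away from `q = 0` and `q = 1`. -/
theorem qHit_inv_of_ne_one {F : Type*} [Field F] {q : F} (hq : q ≠ 0) (hq1 : q ≠ 1) {n : ℕ}
    {c : Fin n → ℕ} (hc : IsFerrers n c) {k : ℕ} (hk : k ≤ n) :
    qHit q⁻¹ n c k =
      q ^ (-(n.choose 2 : ℤ)) * qHit q n (fun j => n - c (Fin.rev j)) (n - k) := by
  have hcomp : (∏ j : Fin n, (1 - C (q ^ (((n - c (Fin.rev j) : ℕ) : ℤ) - (j : ℕ))) * X)).comp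
      (C q⁻¹ * X) = ∏ j : Fin n, (1 - C (q⁻¹ ^ ((c j : ℤ) - (j : ℕ))) * X) := by
    rw [Polynomial.prod_comp, ← Equiv.prod_comp Fin.revPerm]
    refine Finset.prod_congr rfl fun j _ => ?_
    have hj := j.2
    have he : (((n - c j : ℕ) : ℤ) - (Fin.rev j : ℕ)) = -((c j : ℤ) - (j : ℕ)) + 1 := by
      have := hc.2 j
      rw [Fin.val_rev]
      omega
    simp only [Fin.revPerm_apply, Fin.rev_rev, he, sub_comp, one_comp, mul_comp, C_comp, X_comp]
    rw [← mul_assoc, ← C_mul, inv_zpow', zpow_add_one₀ hq, mul_assoc, mul_inv_cancel₀ hq, mul_one]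
  have h1 := one_sub_pow_mul_qHit hq hc.complement (n - k)
  rw [coeff_sub_omitMap hq hk, hcomp, ← one_sub_pow_mul_qHit (inv_ne_zero hq) hc] at h1
  have h2 : (1 - q) ^ n = (-1) ^ n * q ^ n * (1 - q⁻¹) ^ n := by
    rw [← mul_pow, ← mul_pow]
    congr 1
    field_simp
    ring
  have hne : (1 - q) ^ n ≠ 0 := pow_ne_zero n (sub_ne_zero.2 (Ne.symm hq1))
  have h3 : q ^ ((n + 1).choose 2) = q ^ n * q ^ (n.choose 2) := by
    rw [← pow_add, Nat.choose_succ_succ' n 1, Nat.choose_one_right]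
  have h4 : qHit q n (fun j => n - c (Fin.rev j)) (n - k) =
      q ^ (n.choose 2) * qHit q⁻¹ n c k := by
    refine mul_left_cancel₀ hne ?_
    rw [h1, h2, h3]
    ring
  rw [h4, zpow_neg, zpow_natCast, inv_mul_cancel_left₀ (pow_ne_zero _ hq)]

open Polynomial in
theorem map_qHit {R S : Type*} [CommRing R] [CommRing S] (f : R →+* S) (q : R) (n : ℕ)
    (c : Fin n → ℕ) (k : ℕ) : f (qHit q n c k) = qHit (f q) n c k := by
  rw [qHit, qHit, ← coeff_map]
  congr 1
  simp [hitGen, qfact, qint, qRook, Polynomial.map_sum, Polynomial.map_prod]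

open Polynomial in
theorem continuous_qHit {R : Type*} [CommRing R] [TopologicalSpace R] [IsTopologicalRing R]
    (n : ℕ) (c : Fin n → ℕ) (k : ℕ) : Continuous fun q : R => qHit q n c k := by
  have h : ∀ q : R, qHit q n c k = (qHit (X : R[X]) n c k).eval q := fun q => by
    rw [← coe_evalRingHom, map_qHit, coe_evalRingHom, eval_X]
  simp only [h]
  exact Polynomial.continuous _

theorem statement12 (q : ℚ) (hq : q ≠ 0) (n : ℕ) (c : Fin n → ℕ)
    (hc : IsFerrers n c) (k : ℕ) (hk : k ≤ n) :
    qHit q⁻¹ n c k =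
      q ^ (-(n.choose 2 : ℤ)) * qHit q n (fun j => n - c (Fin.rev j)) (n - k) := by
  rcases ne_or_eq q 1 with hq1 | rfl
  · exact qHit_inv_of_ne_one hq hq1 hc hk
  have hl : ContinuousAt (fun x : ℚ => qHit x⁻¹ n c k) 1 :=
    ContinuousAt.comp' (continuous_qHit n c k).continuousAt (continuousAt_inv₀ hq)
  have hr : ContinuousAt (fun x : ℚ => x ^ (-(n.choose 2 : ℤ)) *
      qHit x n (fun j => n - c (Fin.rev j)) (n - k)) 1 :=
    (continuousAt_zpow₀ _ _ (Or.inl hq)).mul (continuous_qHit n _ (n - k)).continuousAt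
  refine tendsto_nhds_unique_of_eventuallyEq
    (hl.tendsto.mono_left (nhdsWithin_le_nhds (s := {1}ᶜ)))
    (hr.tendsto.mono_left nhdsWithin_le_nhds) ?_
  filter_upwards [self_mem_nhdsWithin, nhdsWithin_le_nhds (isOpen_ne.mem_nhds hq)] with x hx1 hx0
  exact qHit_inv_of_ne_one hx0 hx1 hc hk
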